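/- Let N ≥ 2, let F̄ = { X_k X_{k+1}, Y_k Y_{k+1} : 1 ≤ k ≤ N−1 } be the chain Hamiltonian set on N qubits, and let the measurement set be M̄ = { Y_1 Z_2 }. Then the accessible set G = f(Ω, F̄, M̄) is finite with cardinality |G| = (N³ − N²)/2; equivalently, G = ⋃_{k=2}^{N} G_{⌊k}, where G_{⌊k} is the subset of k-finite elements of G and |G_{⌊k}| = (3k − 2)(k − 1)/2 for each 2 ≤ k ≤ N. -/

import Mathlib

open Matrix Complex Kronecker
open scoped Classical

noncomputable section

/-- The state/operator space of an `N`-qubit system, indexed by bit strings. -/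
abbrev Mat (N : ℕ) := Matrix (Fin N → Fin 2) (Fin N → Fin 2) ℂ

/-- The four Pauli matrices: σ₀ = I, σ₁ = X, σ₂ = Y, σ₃ = Z. -/
def pauli (a : Fin 4) : Matrix (Fin 2) (Fin 2) ℂ :=
  if a = 0 then 1
  else if a = 1 then !![0, 1; 1, 0]
  else if a = 2 then !![0, -Complex.I; Complex.I, 0]
  else !![1, 0; 0, -1]

/-- The Pauli string σ_{s 1} ⊗ σ_{s 2} ⊗ ⋯ ⊗ σ_{s N}, realized entrywise. -/
def pauliString {N : ℕ} (s : Fin N → Fin 4) : Mat N :=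
  fun i j => ∏ k, pauli (s k) (i k) (j k)

/-- Ω : the set of all Pauli strings on `N` qubits. -/
def Omega (N : ℕ) : Set (Mat N) := Set.range pauliString

/-- The commutator [A,B] = AB − BA. -/
def mcomm {n : Type*} [Fintype n] (A B : Matrix n n ℂ) : Matrix n n ℂ := A * B - B * A

/-- ⌊A,B⌉ : the unique Pauli string which is a nonzero scalar multiple of [A,B];
it is 0 when no such Pauli string exists (in particular when [A,B] = 0). -/
def pbracket {N : ℕ} (A B : Mat N) : Mat N :=
  if h : ∃ s : Fin N → Fin 4, ∃ c : ℂ, c ≠ 0 ∧ mcomm A B = c • pauliString s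
  then pauliString h.choose else 0

/-- The accessible set f(Ω, F, M) : the smallest set containing M and closed under
adding ⌊τ,ν⌉ for τ already accessible, ν ∈ F with [τ,ν] ≠ 0. -/
inductive Accessible {N : ℕ} (F M : Set (Mat N)) : Mat N → Prop
  | base {O : Mat N} : O ∈ M → Accessible F M O
  | step {τ ν : Mat N} : Accessible F M τ → ν ∈ F → mcomm τ ν ≠ 0 →
      Accessible F M (pbracket τ ν)

/-- The accessible set, as a set. -/
def accSet {N : ℕ} (F M : Set (Mat N)) : Set (Mat N) := {O | Accessible F M O}

/-- Adjacency in the graph with vertex set S, relative to the Hamiltonian set F: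
distinct vertices O_m, O_n are adjacent iff Tr(O_nᴴ [O_m, ν]) ≠ 0 for some ν ∈ F. -/
def Adj {N : ℕ} (F S : Set (Mat N)) (A B : Mat N) : Prop :=
  A ∈ S ∧ B ∈ S ∧ A ≠ B ∧ ∃ ν ∈ F, (Bᴴ * mcomm A ν).trace ≠ 0

/-- Connectivity of the graph on vertex set S: any two vertices are joined by a path. -/
def GraphConnected {N : ℕ} (F S : Set (Mat N)) : Prop :=
  ∀ A ∈ S, ∀ B ∈ S, Relation.ReflTransGen (Adj F S) A B

/-- Index string with value `a` at 0-indexed positions k and k+1, identity elsewhere. -/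
def twoSite (N k : ℕ) (a : Fin 4) : Fin N → Fin 4 :=
  fun j => if (j : ℕ) = k ∨ (j : ℕ) = k + 1 then a else 0

/-- Chain Hamiltonian set F̄_K = {X_jX_{j+1}, Y_jY_{j+1} : 1 ≤ j ≤ K−1 } (1-indexed),
i.e., couplings on 0-indexed positions (t, t+1) with t+1 < K. -/
def chainFk (N K : ℕ) : Set (Mat N) :=
  {O | ∃ t : ℕ, t + 1 < K ∧
    (O = pauliString (twoSite N t 1) ∨ O = pauliString (twoSite N t 2))}

/-- The full chain Hamiltonian set on N qubits. -/
def chainF (N : ℕ) : Set (Mat N) := chainFk N N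

/-- Single-site Pauli string: `a` at 0-indexed position k, identity elsewhere. -/
def singleSite (N k : ℕ) (a : Fin 4) : Fin N → Fin 4 :=
  fun j => if (j : ℕ) = k then a else 0

/-- Z on 0-indexed positions 0,…,m−1, `a` at position m, identity elsewhere. -/
def zTail (N m : ℕ) (a : Fin 4) : Fin N → Fin 4 :=
  fun j => if (j : ℕ) < m then 3 else if (j : ℕ) = m then a else 0

/-- A Pauli string is k-finite (k is 1-indexed) when its k-th factor is not the
identity and all factors beyond position k are the identity. -/
def kFinite {N : ℕ} (k : ℕ) (O : Mat N) : Prop :=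
  ∃ s : Fin N → Fin 4, O = pauliString s ∧
    (∀ j : Fin N, (j : ℕ) + 1 = k → s j ≠ 0) ∧
    (∀ j : Fin N, k ≤ (j : ℕ) → s j = 0)

/-- Path along an edging sequence E: iteratively applying O ↦ ⌊O,ν⌉ along E has
every intermediate commutator nonzero and ends at the indicated operator. -/
def IsPath {N : ℕ} : Mat N → List (Mat N) → Mat N → Prop
  | A, [], B => A = B
  | A, n :: E, B => mcomm A n ≠ 0 ∧ IsPath (pbracket A n) E B

/-- G_{⌊k} : equal to G_1 when k = 1 and to G_k \ G_{k−1} when k > 1. -/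
def Gfloor {N : ℕ} (M : Set (Mat N)) (k : ℕ) : Set (Mat N) :=
  if k = 1 then accSet (chainFk N 1) M
  else accSet (chainFk N k) M \ accSet (chainFk N (k - 1)) M

/-- G¹_{⌊k+1} : the operators in G_{⌊k+1} adjacent, in the graph of G_{k+1},
to some element of G_k. -/
def G1floor {N : ℕ} (M : Set (Mat N)) (k : ℕ) : Set (Mat N) :=
  {O | O ∈ Gfloor M (k + 1) ∧
    ∃ P ∈ accSet (chainFk N k) M,
      Adj (chainFk N (k + 1)) (accSet (chainFk N (k + 1)) M) P O}

/-- The measurement operator Y₁Z₂ (Y at position 1, Z at position 2, 1-indexed). -/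
def Y1Z2 (N : ℕ) : Fin N → Fin 4 :=
  fun j => if (j : ℕ) = 0 then 2 else if (j : ℕ) = 1 then 3 else 0

/-- The accessible set generated by measuring Y₁Z₂ on the N-qubit chain. -/
def G19 (N : ℕ) : Set (Mat N) := accSet (chainF N) {pauliString (Y1Z2 N)}

/-- The commutation sign of two Pauli matrices: `σ_b σ_a = pauliSign a b • σ_a σ_b`. -/
def pauliSign (a b : Fin 4) : ℤ := if a = 0 ∨ b = 0 ∨ a = b then 1 else -1

/-- The commutation sign of two Pauli strings. -/
def stringSign {N : ℕ} (s t : Fin N → Fin 4) : ℤ := ∏ k, pauliSign (s k) (t k)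

/-- The product of two Pauli strings up to a phase, on the level of index strings. -/
def stringMul {N : ℕ} (s t : Fin N → Fin 4) : Fin N → Fin 4 := fun k => s k ^^^ t k

lemma pauli_mul (a b : Fin 4) : ∃ c : ℂ, c ≠ 0 ∧ pauli a * pauli b = c • pauli (a ^^^ b) := by
  have key : ∃ c : ℂ, (c = 1 ∨ c = Complex.I ∨ c = -Complex.I) ∧
      pauli a * pauli b = c • pauli (a ^^^ b) := by
    fin_cases a <;> fin_cases b <;>
    first
    | refine ⟨1, by simp, ?_⟩
      ext i j
      fin_cases i <;> fin_cases j <;> simp [pauli] <;> done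
    | refine ⟨Complex.I, by simp, ?_⟩
      ext i j
      fin_cases i <;> fin_cases j <;> simp [pauli] <;> done
    | refine ⟨-Complex.I, by simp, ?_⟩
      ext i j
      fin_cases i <;> fin_cases j <;> simp [pauli]
  obtain ⟨c, hc, h⟩ := key
  refine ⟨c, ?_, h⟩
  rcases hc with rfl | rfl | rfl <;> simp

lemma pauli_mul_comm (a b : Fin 4) :
    pauli b * pauli a = (pauliSign a b : ℂ) • (pauli a * pauli b) := by
  fin_cases a <;> fin_cases b <;> ext i j <;> fin_cases i <;> fin_cases j <;>
    simp [pauli, pauliSign]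

lemma trace_pauli_mul (a b : Fin 4) :
    (pauli a * pauli b).trace = if a = b then 2 else 0 := by
  fin_cases a <;> fin_cases b <;> simp [pauli, Matrix.trace_fin_two] <;> norm_num

lemma pauliString_mul_apply {N : ℕ} (s t : Fin N → Fin 4) (i j : Fin N → Fin 2) :
    (pauliString s * pauliString t) i j = ∏ k, (pauli (s k) * pauli (t k)) (i k) (j k) := by
  simp only [Matrix.mul_apply, pauliString, ← Finset.prod_mul_distrib]
  rw [Finset.prod_univ_sum, Fintype.piFinset_univ]

lemma trace_pauliString_mul {N : ℕ} (s t : Fin N → Fin 4) :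
    (pauliString s * pauliString t).trace = ∏ k, (if s k = t k then 2 else 0 : ℂ) := by
  simp only [← trace_pauli_mul, Matrix.trace, Matrix.diag, pauliString_mul_apply]
  rw [Finset.prod_univ_sum, Fintype.piFinset_univ]

lemma eq_of_smul_pauliString_eq {N : ℕ} {s t : Fin N → Fin 4} {c d : ℂ} (hc : c ≠ 0)
    (h : c • pauliString s = d • pauliString t) : s = t := by
  have h1 := congrArg (fun A => (A * pauliString s).trace) h
  simp only [Matrix.smul_mul, Matrix.trace_smul, trace_pauliString_mul] at h1
  by_contra hne
  obtain ⟨k, hk⟩ := Function.ne_iff.mp hne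
  rw [Finset.prod_eq_zero (f := fun k => if t k = s k then (2 : ℂ) else 0) (Finset.mem_univ k)
    (if_neg (Ne.symm hk))] at h1
  simp [hc] at h1

lemma pauliString_injective {N : ℕ} :
    Function.Injective (pauliString : (Fin N → Fin 4) → Mat N) := fun s t h =>
  eq_of_smul_pauliString_eq (c := 1) (d := 1) one_ne_zero (by simpa using h)

lemma pauliString_mul {N : ℕ} (s t : Fin N → Fin 4) :
    ∃ c : ℂ, c ≠ 0 ∧ pauliString s * pauliString t = c • pauliString (stringMul s t) := by
  choose c hc h using pauli_mul
  refine ⟨∏ k, c (s k) (t k), Finset.prod_ne_zero_iff.mpr fun k _ => hc _ _, ?_⟩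
  ext i j
  simp [pauliString_mul_apply, h, pauliString, Finset.prod_mul_distrib, stringMul]

lemma pauliString_mul_comm {N : ℕ} (s t : Fin N → Fin 4) :
    pauliString t * pauliString s = (stringSign s t : ℂ) • (pauliString s * pauliString t) := by
  ext i j
  simp only [pauliString_mul_apply, Matrix.smul_apply, stringSign, smul_eq_mul, Int.cast_prod,
    ← Finset.prod_mul_distrib]
  refine Finset.prod_congr rfl fun k _ => ?_
  rw [pauli_mul_comm, Matrix.smul_apply, smul_eq_mul]

lemma mcomm_pauliString_eq_zero {N : ℕ} {s t : Fin N → Fin 4} (h : stringSign s t = 1) :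
    mcomm (pauliString s) (pauliString t) = 0 := by
  simp [mcomm, pauliString_mul_comm s t, h]

lemma mcomm_pauliString_of_sign_neg {N : ℕ} {s t : Fin N → Fin 4} (h : stringSign s t = -1) :
    ∃ c : ℂ, c ≠ 0 ∧
      mcomm (pauliString s) (pauliString t) = c • pauliString (stringMul s t) := by
  obtain ⟨c, hc, hm⟩ := pauliString_mul s t
  refine ⟨2 * c, by simpa using hc, ?_⟩
  simp only [mcomm, pauliString_mul_comm s t, h, hm]
  push_cast
  module

lemma mcomm_pauliString_ne_zero {N : ℕ} {s t : Fin N → Fin 4} (h : stringSign s t = -1) :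
    mcomm (pauliString s) (pauliString t) ≠ 0 := by
  obtain ⟨c, hc, hm⟩ := mcomm_pauliString_of_sign_neg h
  intro h0
  have h1 := congrArg (fun A => (A * pauliString (stringMul s t)).trace) (hm.symm.trans h0)
  simp [trace_pauliString_mul, hc] at h1

lemma pbracket_pauliString {N : ℕ} {s t : Fin N → Fin 4} (h : stringSign s t = -1) :
    pbracket (pauliString s) (pauliString t) = pauliString (stringMul s t) := by
  obtain ⟨c, hc, hm⟩ := mcomm_pauliString_of_sign_neg h
  have hex : ∃ u : Fin N → Fin 4, ∃ c : ℂ, c ≠ 0 ∧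
      mcomm (pauliString s) (pauliString t) = c • pauliString u := ⟨_, c, hc, hm⟩
  rw [pbracket, dif_pos hex]
  obtain ⟨d, hd, hd'⟩ := hex.choose_spec
  rw [eq_of_smul_pauliString_eq hc (hm.symm.trans hd')]

lemma stringSign_mul_left {N : ℕ} (s t u : Fin N → Fin 4) :
    stringSign (stringMul s t) u = stringSign s u * stringSign t u := by
  have key : ∀ a b c : Fin 4, pauliSign (a ^^^ b) c = pauliSign a c * pauliSign b c := by
    unfold pauliSign; decide
  simp [stringSign, stringMul, key, Finset.prod_mul_distrib]

lemma stringSign_comm {N : ℕ} (s t : Fin N → Fin 4) : stringSign s t = stringSign t s := by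
  have key : ∀ a b : Fin 4, pauliSign a b = pauliSign b a := by
    unfold pauliSign; decide
  exact Finset.prod_congr rfl fun k _ => key _ _

lemma stringSign_mul_right {N : ℕ} (s t u : Fin N → Fin 4) :
    stringSign s (stringMul t u) = stringSign s t * stringSign s u := by
  rw [stringSign_comm, stringSign_mul_left, stringSign_comm t, stringSign_comm u]

/-- The final letter of a Jordan-Wigner Majorana string; it alternates with the site. -/
def majoranaLetter (e : Bool) (k : ℕ) : Fin 4 := if (k.bodd ^^ e) = true then 1 else 2

/-- The Majorana strings, split into two families (`e = false` and `e = true`) so that each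
coupling of the chain is a product of two consecutive Majoranas of one family. -/
def majorana (N : ℕ) (e : Bool) (k : ℕ) : Fin N → Fin 4 := zTail N k (majoranaLetter e k)

lemma stringSign_majorana_of_lt {N : ℕ} (e f : Bool) {i j : ℕ} (hij : i < j) (hj : j < N) :
    stringSign (majorana N e i) (majorana N f j) = -1 := by
  rw [stringSign, Finset.prod_eq_single ⟨i, hij.trans hj⟩]
  · simp only [majorana, zTail, majoranaLetter, hij]
    split_ifs <;> simp_all [pauliSign]
  · intro k _ hk
    have hk' : (k : ℕ) ≠ i := fun h => hk (Fin.ext h)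
    simp only [majorana, zTail]
    split_ifs <;> first | omega | simp [pauliSign]
  · simp

lemma stringSign_majorana {N : ℕ} (e f : Bool) {i j : ℕ} (hi : i < N) (hj : j < N) :
    stringSign (majorana N e i) (majorana N f j) = if e = f ∧ i = j then 1 else -1 := by
  rcases lt_trichotomy i j with h | rfl | h
  · rw [stringSign_majorana_of_lt e f h hj, if_neg (by omega)]
  · rw [stringSign, Finset.prod_eq_single ⟨i, hi⟩]
    · simp only [majorana, zTail, majoranaLetter]
      cases i.bodd <;> cases e <;> cases f <;> simp [pauliSign]
    · intro k _ hk
      have hk' : (k : ℕ) ≠ i := fun h => hk (Fin.ext h)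
      simp only [majorana, zTail, if_neg hk']
      simp [pauliSign]
    · simp
  · rw [stringSign_comm, stringSign_majorana_of_lt f e h hi, if_neg (by omega)]

lemma twoSite_eq_stringMul_majorana (N : ℕ) (e : Bool) (k : ℕ) :
    twoSite N k (majoranaLetter e (k + 1)) =
      stringMul (majorana N e k) (majorana N e (k + 1)) := by
  ext j
  simp only [twoSite, stringMul, majorana, zTail, majoranaLetter, Nat.bodd_succ]
  cases k.bodd <;> cases e <;> split_ifs <;> first | rfl | omega | simp_all

lemma mem_chainF_iff {N : ℕ} {O : Mat N} : O ∈ chainF N ↔ ∃ k, k + 1 < N ∧ ∃ e,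
    O = pauliString (stringMul (majorana N e k) (majorana N e (k + 1))) := by
  simp only [← twoSite_eq_stringMul_majorana, chainF, chainFk, Set.mem_ofPred_eq]
  refine exists_congr fun k => and_congr_right fun _ => ?_
  rw [Bool.exists_bool]
  simp only [majoranaLetter]
  cases (k + 1).bodd <;> simp [or_comm]

/-- The product of the Majoranas `i` and `j` of the first family and `l` of the second. -/
def tripleString (N i j l : ℕ) : Fin N → Fin 4 :=
  stringMul (stringMul (majorana N false i) (majorana N false j)) (majorana N true l)

lemma tripleString_swap (N i j l : ℕ) : tripleString N i j l = tripleString N j i l := by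
  have key : ∀ a b c : Fin 4, a ^^^ b ^^^ c = b ^^^ a ^^^ c := by decide
  ext k
  simp only [tripleString, stringMul, key]

lemma tripleString_mul_first (N j l i i' : ℕ) :
    stringMul (tripleString N i j l) (stringMul (majorana N false i) (majorana N false i')) =
      tripleString N i' j l := by
  have key : ∀ a b c d : Fin 4, (a ^^^ b ^^^ c) ^^^ (a ^^^ d) = d ^^^ b ^^^ c := by decide
  ext k
  simp only [tripleString, stringMul, key]

lemma tripleString_mul_third (N i j l l' : ℕ) :
    stringMul (tripleString N i j l) (stringMul (majorana N true l) (majorana N true l')) =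
      tripleString N i j l' := by
  have key : ∀ a b c d : Fin 4, (a ^^^ b ^^^ c) ^^^ (c ^^^ d) = a ^^^ b ^^^ d := by decide
  ext k
  simp only [tripleString, stringMul, key]

lemma stringMul_comm {N : ℕ} (s t : Fin N → Fin 4) : stringMul s t = stringMul t s := by
  have key : ∀ a b : Fin 4, a ^^^ b = b ^^^ a := by decide
  ext k
  simp only [stringMul, key (s k)]

lemma stringSign_tripleString_majorana {N i j l m : ℕ} (hi : i < N) (hj : j < N) (hl : l < N)
    (hm : m < N) (e : Bool) :
    stringSign (tripleString N i j l) (majorana N e m) =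
      (if false = e ∧ i = m then 1 else -1) * (if false = e ∧ j = m then 1 else -1) *
        (if true = e ∧ l = m then 1 else -1) := by
  rw [tripleString, stringSign_mul_left, stringSign_mul_left, stringSign_majorana _ _ hi hm,
    stringSign_majorana _ _ hj hm, stringSign_majorana _ _ hl hm]

lemma accessible_step {N : ℕ} {M : Set (Mat N)} {s : Fin N → Fin 4} {k : ℕ} {e : Bool}
    (hk : k + 1 < N) (hs : Accessible (chainF N) M (pauliString s))
    (hsign : stringSign s (stringMul (majorana N e k) (majorana N e (k + 1))) = -1) :
    Accessible (chainF N) M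
      (pauliString (stringMul s (stringMul (majorana N e k) (majorana N e (k + 1))))) := by
  rw [← pbracket_pauliString hsign]
  exact hs.step (mem_chainF_iff.mpr ⟨k, hk, e, rfl⟩) (mcomm_pauliString_ne_zero hsign)

lemma Y1Z2_eq_tripleString (N : ℕ) : Y1Z2 N = tripleString N 0 1 1 := by
  ext k
  simp only [Y1Z2, tripleString, stringMul, majorana, zTail, majoranaLetter]
  obtain ⟨k, hk⟩ := k
  rcases k with _ | _ | k <;> simp

lemma exists_tripleString_of_mem_G19 {N : ℕ} (hN : 2 ≤ N) {O : Mat N} (hO : O ∈ G19 N) :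
    ∃ i j l, i < N ∧ j < N ∧ l < N ∧ i ≠ j ∧ O = pauliString (tripleString N i j l) := by
  induction hO with
  | base h =>
    rw [Set.mem_singleton_iff.mp h, Y1Z2_eq_tripleString]
    exact ⟨0, 1, 1, by omega, by omega, by omega, by omega, rfl⟩
  | @step τ ν _ hν hne ih =>
    obtain ⟨i, j, l, hi, hj, hl, hij, rfl⟩ := ih
    obtain ⟨k, hk, e, rfl⟩ := mem_chainF_iff.mp hν
    have hsign : stringSign (tripleString N i j l)
        (stringMul (majorana N e k) (majorana N e (k + 1))) ≠ 1 :=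
      fun h => hne (mcomm_pauliString_eq_zero h)
    have hsign' : stringSign (tripleString N i j l)
        (stringMul (majorana N e k) (majorana N e (k + 1))) = -1 := by
      have hk' : k < N := by omega
      revert hsign
      rw [stringSign_mul_right, stringSign_tripleString_majorana hi hj hl hk',
        stringSign_tripleString_majorana hi hj hl hk]
      split_ifs <;> simp
    rw [pbracket_pauliString hsign']
    rw [stringSign_mul_right, stringSign_tripleString_majorana hi hj hl (by omega),
      stringSign_tripleString_majorana hi hj hl hk] at hsign
    cases e
    · have hcases : (i = k ∧ j ≠ k + 1) ∨ (i = k + 1 ∧ j ≠ k) ∨ (j = k ∧ i ≠ k + 1) ∨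
          (j = k + 1 ∧ i ≠ k) := by
        by_contra hcon
        apply hsign
        simp only [true_and, Bool.true_eq_false, false_and, if_false]
        split_ifs <;> omega
      rcases hcases with ⟨rfl, h⟩ | ⟨rfl, h⟩ | ⟨rfl, h⟩ | ⟨rfl, h⟩
      · exact ⟨i + 1, j, l, hk, hj, hl, h.symm, by rw [tripleString_mul_first]⟩
      · exact ⟨k, j, l, by omega, hj, hl, h.symm, by
          rw [stringMul_comm (majorana N false k), tripleString_mul_first]⟩
      · exact ⟨j + 1, i, l, hk, hi, hl, h.symm, by
          rw [tripleString_swap, tripleString_mul_first]⟩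
      · exact ⟨k, i, l, by omega, hi, hl, h.symm, by
          rw [tripleString_swap, stringMul_comm (majorana N false k), tripleString_mul_first]⟩
    · have hcases : l = k ∨ l = k + 1 := by
        by_contra hcon
        apply hsign
        simp only [true_and, Bool.false_eq_true, false_and, if_false]
        split_ifs <;> omega
      rcases hcases with rfl | rfl
      · exact ⟨i, j, l + 1, hi, hj, hk, hij, by rw [tripleString_mul_third]⟩
      · exact ⟨i, j, k, hi, hj, by omega, hij, by
          rw [stringMul_comm (majorana N true k), tripleString_mul_third]⟩

lemma tripleString_step_first {N i j l : ℕ} (hi : i + 1 < N) (hj : j < N) (hl : l < N)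
    (hij : i ≠ j) (hij' : i + 1 ≠ j) (h : pauliString (tripleString N i j l) ∈ G19 N) :
    pauliString (tripleString N (i + 1) j l) ∈ G19 N := by
  rw [← tripleString_mul_first N j l i (i + 1)]
  refine accessible_step hi h ?_
  rw [stringSign_mul_right, stringSign_tripleString_majorana (by omega) hj hl (by omega),
    stringSign_tripleString_majorana (by omega) hj hl hi]
  simp [hij.symm, hij'.symm]

lemma stringSign_tripleString_third {N i j l m : ℕ} (hi : i < N) (hj : j < N) (hl : l < N)
    (hm : m + 1 < N) (h : l = m ∨ l = m + 1) :
    stringSign (tripleString N i j l)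
      (stringMul (majorana N true m) (majorana N true (m + 1))) = -1 := by
  rw [stringSign_mul_right, stringSign_tripleString_majorana hi hj hl (by omega),
    stringSign_tripleString_majorana hi hj hl hm]
  rcases h with rfl | rfl <;> simp

lemma tripleString_mem_G19 {N i j l : ℕ} (hij : i < j) (hj : j < N) (hl : l < N) :
    pauliString (tripleString N i j l) ∈ G19 N := by
  have h01 : ∀ l, l < N → pauliString (tripleString N 0 1 l) ∈ G19 N := by
    intro l
    induction l with
    | zero =>
      intro _
      have h : Accessible (chainF N) {pauliString (Y1Z2 N)}
          (pauliString (tripleString N 0 1 1)) :=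
        .base (by rw [Y1Z2_eq_tripleString]; rfl)
      rw [← tripleString_mul_third N 0 1 1 0, stringMul_comm (majorana N true 1)]
      exact accessible_step (by omega) h
        (stringSign_tripleString_third (by omega) (by omega) (by omega) (by omega) (.inr rfl))
    | succ l ih =>
      intro hl
      rw [← tripleString_mul_third N 0 1 l (l + 1)]
      exact accessible_step hl (ih (by omega))
        (stringSign_tripleString_third (by omega) (by omega) (by omega) hl (.inl rfl))
  have h0 : ∀ j, j + 1 < N → pauliString (tripleString N 0 (j + 1) l) ∈ G19 N := by
    intro j
    induction j with
    | zero => exact fun _ => h01 l hl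
    | succ j ih =>
      intro hj
      rw [tripleString_swap]
      refine tripleString_step_first hj (by omega) hl (by omega) (by omega) ?_
      rw [tripleString_swap]
      exact ih (by omega)
  induction i with
  | zero =>
    obtain ⟨j, rfl⟩ := Nat.exists_eq_succ_of_ne_zero hij.ne'
    exact h0 j hj
  | succ i ih =>
    exact tripleString_step_first (by omega) hj hl (by omega) (by omega) (ih (by omega))

/-- The index triples `((j, i), l)` with `i < j < n` and `l < n`. -/
def tripleIndices (n : ℕ) : Finset ((_ : ℕ) × ℕ × ℕ) :=
  (Finset.range n).sigma fun j => Finset.range j ×ˢ Finset.range n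

/-- The Pauli string attached to an index triple. -/
def triplePauli (N : ℕ) (x : (_ : ℕ) × ℕ × ℕ) : Mat N :=
  pauliString (tripleString N x.2.1 x.1 x.2.2)

lemma mem_tripleIndices {n : ℕ} {x : (_ : ℕ) × ℕ × ℕ} :
    x ∈ tripleIndices n ↔ x.1 < n ∧ x.2.1 < x.1 ∧ x.2.2 < n := by
  simp [tripleIndices]

lemma card_tripleIndices (n : ℕ) : 2 * (tripleIndices n).card = n * (n * (n - 1)) := by
  simp only [tripleIndices, Finset.card_sigma, Finset.card_product, Finset.card_range,
    ← Finset.sum_mul]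
  rw [← Finset.sum_range_id_mul_two]
  ring

lemma G19_eq_image {N : ℕ} (hN : 2 ≤ N) :
    G19 N = triplePauli N '' (tripleIndices N : Set _) := by
  ext O
  constructor
  · intro hO
    obtain ⟨i, j, l, hi, hj, hl, hij, rfl⟩ := exists_tripleString_of_mem_G19 hN hO
    rcases lt_or_gt_of_ne hij with h | h
    · exact ⟨⟨j, i, l⟩, mem_tripleIndices.mpr ⟨hj, h, hl⟩, rfl⟩
    · exact ⟨⟨i, j, l⟩, mem_tripleIndices.mpr ⟨hi, h, hl⟩, by
        rw [triplePauli, tripleString_swap]⟩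
  · rintro ⟨x, hx, rfl⟩
    obtain ⟨hj, hij, hl⟩ := mem_tripleIndices.mp hx
    exact tripleString_mem_G19 hij hj hl

lemma injOn_triplePauli (N : ℕ) : Set.InjOn (triplePauli N) (tripleIndices N : Set _) := by
  rintro ⟨j, i, l⟩ hx ⟨j', i', l'⟩ hx' h
  obtain ⟨hj, hij, hl⟩ := mem_tripleIndices.mp hx
  obtain ⟨hj', hij', hl'⟩ := mem_tripleIndices.mp hx'
  dsimp only at hj hij hl hj' hij' hl'
  have hs : tripleString N i j l = tripleString N i' j' l' := pauliString_injective h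
  have key : ∀ (e : Bool) (m : ℕ), m < N → _ := fun e m hm =>
    (stringSign_tripleString_majorana (hij.trans hj) hj hl hm e).symm.trans
      ((congrArg (stringSign · (majorana N e m)) hs).trans
        (stringSign_tripleString_majorana (hij'.trans hj') hj' hl' hm e))
  have hll : l = l' := by
    have := key true l hl
    by_contra hne
    simp [Ne.symm hne] at this
  have hi : i = i' ∨ i = j' := by
    have := key false i (hij.trans hj)
    by_contra! hne
    simp [hne.1.symm, hne.2.symm, hij.ne'] at this
  have hjj : j = i' ∨ j = j' := by
    have := key false j hj
    by_contra! hne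
    simp [hne.1.symm, hne.2.symm, hij.ne] at this
  obtain rfl : i = i' := by omega
  obtain rfl : j = j' := by omega
  rw [hll]

lemma majorana_of_lt {N k : ℕ} (e : Bool) {m : Fin N} (h : k < m) : majorana N e k m = 0 := by
  simp only [majorana, zTail]
  rw [if_neg (by omega), if_neg (by omega)]

lemma majorana_self {N k : ℕ} (e : Bool) {m : Fin N} (h : (m : ℕ) = k) :
    majorana N e k m = majoranaLetter e k := by
  simp [majorana, zTail, h]

lemma tripleString_apply_of_lt {N i j l : ℕ} (hij : i < j) {m : Fin N} (hm : max j l < m) :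
    tripleString N i j l m = 0 := by
  rw [tripleString, stringMul, stringMul, majorana_of_lt _ (by omega),
    majorana_of_lt _ (by omega), majorana_of_lt _ (by omega)]
  rfl

lemma tripleString_apply_max_ne_zero {N i j l : ℕ} (hij : i < j) {m : Fin N}
    (hm : (m : ℕ) = max j l) : tripleString N i j l m ≠ 0 := by
  rw [tripleString, stringMul, stringMul, majorana_of_lt _ (by omega : i < m)]
  rcases lt_trichotomy j l with h | rfl | h
  · rw [majorana_of_lt _ (by omega : j < m), majorana_self _ (by omega : (m : ℕ) = l)]
    cases hb : l.bodd <;> simp [majoranaLetter, hb]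
  · rw [majorana_self _ (by omega : (m : ℕ) = j), majorana_self _ (by omega : (m : ℕ) = j)]
    cases hb : j.bodd <;> simp [majoranaLetter, hb]
  · rw [majorana_of_lt _ (by omega : l < m), majorana_self _ (by omega : (m : ℕ) = j)]
    cases hb : j.bodd <;> simp [majoranaLetter, hb]

lemma kFinite_tripleString_iff {N i j l k : ℕ} (hij : i < j) (hj : j < N) (hl : l < N)
    (hk : 1 ≤ k) (hkN : k ≤ N) :
    kFinite k (pauliString (tripleString N i j l)) ↔ k = max j l + 1 := by
  constructor
  · rintro ⟨s, hs, h1, h2⟩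
    obtain rfl := pauliString_injective hs
    by_contra hne
    rcases lt_or_gt_of_ne hne with h | h
    · exact tripleString_apply_max_ne_zero hij rfl
        (h2 (⟨max j l, max_lt hj hl⟩ : Fin N) (Nat.lt_succ_iff.mp h))
    · exact h1 (⟨k - 1, by omega⟩ : Fin N) (Nat.sub_add_cancel hk)
        (tripleString_apply_of_lt hij (show max j l < k - 1 by omega))
  · rintro rfl
    exact ⟨_, rfl, fun m hm => tripleString_apply_max_ne_zero hij (by omega),
      fun m hm => tripleString_apply_of_lt hij hm⟩

lemma setOf_kFinite_G19_eq_image {N k : ℕ} (hN : 2 ≤ N) (hk : 1 ≤ k) (hkN : k ≤ N) :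
    {O ∈ G19 N | kFinite k O} =
      triplePauli N '' ((tripleIndices k \ tripleIndices (k - 1) : Finset _) : Set _) := by
  rw [G19_eq_image hN]
  ext O
  simp only [Set.mem_ofPred_eq, Set.mem_image, Finset.mem_coe, Finset.mem_sdiff]
  constructor
  · rintro ⟨⟨x, hx, rfl⟩, hfin⟩
    rw [mem_tripleIndices] at hx
    have hmax := (kFinite_tripleString_iff hx.2.1 hx.1 hx.2.2 hk hkN).mp hfin
    refine ⟨x, ?_, rfl⟩
    rw [mem_tripleIndices, mem_tripleIndices]
    omega
  · rintro ⟨x, hx, rfl⟩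
    rw [mem_tripleIndices, mem_tripleIndices] at hx
    refine ⟨⟨x, mem_tripleIndices.mpr (by omega), rfl⟩, ?_⟩
    exact (kFinite_tripleString_iff hx.1.2.1 (by omega) (by omega) hk hkN).mpr (by omega)

lemma tripleIndices_mono {m n : ℕ} (h : m ≤ n) : tripleIndices m ⊆ tripleIndices n := by
  intro x
  simp only [mem_tripleIndices]
  omega

lemma ncard_triplePauli_image {N : ℕ} {S : Finset ((_ : ℕ) × ℕ × ℕ)}
    (hS : S ⊆ tripleIndices N) : (triplePauli N '' (S : Set _)).ncard = S.card := by
  rw [((injOn_triplePauli N).mono (by exact_mod_cast hS)).ncard_image,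
    Set.ncard_coe_finset]

theorem stmt_19 {N : ℕ} (hN : 2 ≤ N) :
    (G19 N).Finite ∧
    (G19 N).ncard = (N ^ 3 - N ^ 2) / 2 ∧
    G19 N = ⋃ k ∈ Finset.Icc 2 N, {O ∈ G19 N | kFinite k O} ∧
    ∀ k : ℕ, 2 ≤ k → k ≤ N →
      ({O ∈ G19 N | kFinite k O}).ncard = (3 * k - 2) * (k - 1) / 2 := by
  refine ⟨?_, ?_, ?_, fun k hk hkN => ?_⟩
  · rw [G19_eq_image hN]
    exact (Finset.finite_toSet _).image _
  · rw [G19_eq_image hN, ncard_triplePauli_image subset_rfl]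
    have h := card_tripleIndices N
    obtain ⟨n, rfl⟩ := Nat.exists_eq_add_of_le' (show 1 ≤ N by omega)
    have h3 : (n + 1) ^ 3 - (n + 1) ^ 2 = (n + 1) * ((n + 1) * n) :=
      Nat.sub_eq_of_eq_add (by ring)
    rw [Nat.add_sub_cancel] at h
    omega
  · refine Set.Subset.antisymm (fun O hO => ?_) (Set.iUnion₂_subset fun k _ => Set.sep_subset _ _)
    have hO' := hO
    rw [G19_eq_image hN] at hO'
    obtain ⟨x, hx, rfl⟩ := hO'
    rw [Finset.mem_coe, mem_tripleIndices] at hx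
    refine Set.mem_iUnion₂.mpr ⟨max x.1 x.2.2 + 1, Finset.mem_Icc.mpr (by omega), hO, ?_⟩
    exact (kFinite_tripleString_iff hx.2.1 hx.1 hx.2.2 (by omega) (by omega)).mpr rfl
  · rw [setOf_kFinite_G19_eq_image hN (by omega) hkN, ncard_triplePauli_image
      (Finset.sdiff_subset.trans (tripleIndices_mono hkN)),
      Finset.card_sdiff_of_subset (tripleIndices_mono (Nat.sub_le k 1))]
    have h1 := card_tripleIndices k
    have h2 := card_tripleIndices (k - 1)
    obtain ⟨n, rfl⟩ := Nat.exists_eq_add_of_le' hk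
    have e1 : n + 2 - 1 = n + 1 := rfl
    have e2 : 3 * (n + 2) - 2 = 3 * n + 4 := by omega
    rw [e1] at h1 h2 ⊢
    rw [e2]
    rw [Nat.add_sub_cancel] at h2
    have e3 : (n + 2) * ((n + 2) * (n + 1)) =
      (n + 1) * ((n + 1) * n) + (3 * n + 4) * (n + 1) := by ring
    omega
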